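/- Let p > 3 be a prime with p ≡ 2 (mod 3), and let F be a finite field with p^m elements where m is even. Let χ be a multiplicative character of F of order exactly 3 and let α ∈ F^×. Then G_F(χ, ψ_α) = χ(α)^{−1} · (−p)^{m/2}. In particular the value does not depend on the choice of the nontrivial additive character ψ_p of F_p used to define ψ_α. -/

import Mathlib

/-- The additive character `ψ_α : x ↦ ψ_p(Tr_{F/F_p}(α·x))` of a finite field `F` of
characteristic `p`, built from a fixed additive character `ψ_p` of `F_p = ZMod p`. -/
noncomputable def psiAlpha {p : ℕ} [Fact p.Prime] {F : Type} [Field F] [Fintype F]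
    [Algebra (ZMod p) F] (ψp : AddChar (ZMod p) ℂ) (α : F) : AddChar F ℂ :=
  ψp.compAddMonoidHom
    ((Algebra.trace (ZMod p) F).toAddMonoidHom.comp (AddMonoidHom.mulLeft α))

/-- Orthogonality for the powers of a character whose cube is trivial. -/
lemma one_add_mulChar_add_inv {F : Type*} [Field F] {χ : MulChar F ℂ} (hχ : χ ^ 3 = 1)
    {x : F} (hx : x ≠ 0) : 1 + χ x + χ⁻¹ x = 3 * if χ x = 1 then 1 else 0 := by
  have h3 : χ x ^ 3 = 1 := by
    rw [← MulChar.pow_apply' χ (by norm_num), hχ, MulChar.one_apply (isUnit_iff_ne_zero.mpr hx)]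
  have hinv : χ⁻¹ = χ ^ 2 := inv_eq_of_mul_eq_one_right (by rw [← pow_succ', hχ])
  rw [hinv, MulChar.pow_apply' χ (by norm_num)]
  split_ifs with h
  · rw [h]; norm_num
  · have : (χ x - 1) * (1 + χ x + χ x ^ 2) = 0 := by linear_combination h3
    simpa [sub_eq_zero, h] using this

lemma mulChar_neg_one_eq_one {F R : Type*} [CommRing F] [CommRing R] {χ : MulChar F R}
    (hχ : χ ^ 3 = 1) : χ (-1) = 1 := by
  have h3 : χ (-1) ^ 3 = 1 := by
    rw [← MulChar.pow_apply' χ (by norm_num), hχ, MulChar.one_apply isUnit_one.neg]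
  have h2 : χ (-1) ^ 2 = 1 := by rw [← map_pow]; simp
  linear_combination h3 - χ (-1) * h2

/-- The sum of the two Gauss sums of a cubic character and its inverse is congruent to `1`
modulo `3` in the ring of algebraic integers. -/
lemma exists_isIntegral_gaussSum_add_gaussSum_inv {F : Type*} [Field F] [Fintype F]
    {χ : MulChar F ℂ} (hχ : χ ^ 3 = 1) {ψ : AddChar F ℂ} (hψ : ψ ≠ 1) :
    ∃ S : ℂ, IsIntegral ℤ S ∧ gaussSum χ ψ + gaussSum χ⁻¹ ψ - 1 = 3 * S := by
  classical
  refine ⟨∑ x : F, if χ x = 1 then ψ x else 0, ?_, ?_⟩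
  · refine IsIntegral.sum _ fun x _ ↦ ?_
    split_ifs
    · have : (ψ x) ^ Fintype.card F = 1 := by
        rw [← AddChar.map_nsmul_eq_pow, card_nsmul_eq_zero, AddChar.map_zero_eq_one]
      exact IsIntegral.of_pow Fintype.card_pos (this ▸ isIntegral_one)
    · exact isIntegral_zero
  · have h1 : gaussSum (1 : MulChar F ℂ) ψ = -1 := by simpa using gaussSum_one_left hψ
    rw [show gaussSum χ ψ + gaussSum χ⁻¹ ψ - 1
      = gaussSum (1 : MulChar F ℂ) ψ + gaussSum χ ψ + gaussSum χ⁻¹ ψ by rw [h1]; ring]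
    simp only [gaussSum, ← Finset.sum_add_distrib, Finset.mul_sum]
    refine Finset.sum_congr rfl fun x _ ↦ ?_
    rcases eq_or_ne x 0 with rfl | hx
    · simp [MulChar.map_zero]
    · rw [MulChar.one_apply (isUnit_iff_ne_zero.mpr hx), ← add_mul, ← add_mul,
        one_add_mulChar_add_inv hχ hx]
      split_ifs <;> simp

lemma dvd_of_isIntegral_of_cast_eq_mul {n d : ℤ} (hd : d ≠ 0) {S : ℂ} (hS : IsIntegral ℤ S)
    (h : (n : ℂ) = d * S) : d ∣ n := by
  have hd' : (d : ℂ) ≠ 0 := by exact_mod_cast hd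
  have hS' : S = algebraMap ℚ ℂ (n / d) := by
    rw [eq_ratCast]; push_cast; field_simp; rw [h]; ring
  rw [hS', isIntegral_algebraMap_iff (algebraMap ℚ ℂ).injective] at hS
  obtain ⟨k, hk⟩ := IsIntegrallyClosed.isIntegral_iff.mp hS
  have hd'' : (d : ℚ) ≠ 0 := by exact_mod_cast hd
  refine ⟨k, ?_⟩
  rw [eq_intCast, eq_div_iff hd''] at hk
  have : (n : ℚ) = d * k := by rw [← hk]; ring
  exact_mod_cast this

lemma gaussSum_pow_eq_gaussSum {F R : Type*} [Field F] [Fintype F] [CommRing R]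
    (p : ℕ) [Fact p.Prime] [CharP F p] (χ : MulChar F R) {ψ : AddChar F R}
    (hψ : ∀ x, ψ (x ^ p) = ψ x) : gaussSum (χ ^ p) ψ = gaussSum χ ψ := by
  have hp0 : p ≠ 0 := (Fact.out : p.Prime).ne_zero
  have hb : Function.Bijective (frobenius F p) :=
    Finite.injective_iff_bijective.mp (frobenius_inj F p)
  refine Fintype.sum_bijective _ hb _ _ fun x ↦ ?_
  rw [frobenius_def, hψ, map_pow, MulChar.pow_apply' χ hp0]

section psiAlpha

variable {p : ℕ} [Fact p.Prime] {F : Type} [Field F] [Fintype F] [Algebra (ZMod p) F]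

lemma psiAlpha_apply (ψp : AddChar (ZMod p) ℂ) (α x : F) :
    psiAlpha ψp α x = ψp (Algebra.trace (ZMod p) F (α * x)) := rfl

lemma psiAlpha_eq_mulShift (ψp : AddChar (ZMod p) ℂ) (α : F) :
    psiAlpha ψp α = (psiAlpha ψp 1).mulShift α := by
  ext x
  simp [psiAlpha_apply, AddChar.mulShift_apply]

lemma psiAlpha_one_ne_one {ψp : AddChar (ZMod p) ℂ} (hψ : ψp ≠ 1) :
    psiAlpha ψp (1 : F) ≠ 1 := by
  obtain ⟨y, hy⟩ := AddChar.ne_one_iff.mp hψ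
  obtain ⟨x, rfl⟩ := Algebra.trace_surjective (ZMod p) F y
  refine AddChar.ne_one_iff.mpr ⟨x, ?_⟩
  rwa [psiAlpha_apply, one_mul]

lemma psiAlpha_one_pow (ψp : AddChar (ZMod p) ℂ) (x : F) :
    psiAlpha ψp 1 (x ^ p) = psiAlpha ψp 1 x := by
  have h := Algebra.trace_eq_of_algEquiv (FiniteField.frobeniusAlgEquivOfAlgebraic (ZMod p) F) x
  rw [FiniteField.coe_frobeniusAlgEquivOfAlgebraic, ZMod.card] at h
  rw [psiAlpha_apply, psiAlpha_apply, one_mul, one_mul, h]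

end psiAlpha

/-- The value of a cubic Gauss sum in a characteristic congruent to `2` modulo `3`, for an
additive character that is invariant under Frobenius. -/
lemma gaussSum_eq_of_orderOf_eq_three {p : ℕ} [Fact p.Prime] (hp3 : p % 3 = 2)
    {F : Type*} [Field F] [Fintype F] [CharP F p] {k : ℕ} (hF : Fintype.card F = p ^ (2 * k))
    {χ : MulChar F ℂ} (hχ : orderOf χ = 3) {ψ : AddChar F ℂ} (hψ : ψ ≠ 1)
    (hψp : ∀ x, ψ (x ^ p) = ψ x) : gaussSum χ ψ = -(-(p : ℂ)) ^ k := by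
  have hχ3 : χ ^ 3 = 1 := hχ ▸ pow_orderOf_eq_one χ
  have hχ1 : χ ≠ 1 := by rintro rfl; simp at hχ
  have hχp : χ ^ p = χ⁻¹ := by
    rw [← Nat.div_add_mod p 3, hp3, pow_add, pow_mul, hχ3, one_pow, one_mul]
    exact (inv_eq_of_mul_eq_one_right (by rw [← pow_succ', hχ3])).symm
  have hinv : gaussSum χ⁻¹ ψ = gaussSum χ ψ := by
    rw [← hχp, gaussSum_pow_eq_gaussSum p χ hψp]
  have hsq : gaussSum χ ψ ^ 2 = ((-(p : ℂ)) ^ k) ^ 2 := by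
    have h1 := gaussSum_mul_gaussSum_eq_card hχ1 (AddChar.IsPrimitive.of_ne_one hψ)
    have h2 := mul_gaussSum_inv_eq_gaussSum χ⁻¹ ψ
    rw [mulChar_neg_one_eq_one (by rw [inv_pow, hχ3, inv_one]), one_mul, hinv] at h2
    rw [h2, hF] at h1
    rw [sq, h1, ← pow_mul, mul_comm k, pow_mul (-(p : ℂ)), neg_sq, ← pow_mul]
    push_cast
    rfl
  refine (sq_eq_sq_iff_eq_or_eq_neg.mp hsq).resolve_left fun h ↦ ?_
  obtain ⟨S, hS, hSe⟩ := exists_isIntegral_gaussSum_add_gaussSum_inv hχ3 hψ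
  rw [hinv, h] at hSe
  have hdvd : (3 : ℤ) ∣ 2 * (-(p : ℤ)) ^ k - 1 :=
    dvd_of_isIntegral_of_cast_eq_mul (by norm_num) hS (by push_cast; rw [← hSe]; ring)
  have hmod : (-(p : ℤ)) ^ k ≡ 1 ^ k [ZMOD 3] := by
    refine Int.ModEq.pow k ?_
    rw [Int.ModEq]
    omega
  rw [one_pow, Int.ModEq] at hmod
  omega

/-- Let `p > 3` be a prime with `p ≡ 2 (mod 3)` and `F` a finite field with
`p^m` elements, `m` even.  For every multiplicative character `χ` of `F` of order exactly 3
and every `α ∈ F^×`, one has `G_F(χ, ψ_α) = χ(α)⁻¹·(−p)^{m/2}`, where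
`G_F(·,·) = −gaussSum` (in particular the value does not depend on the choice of the
nontrivial additive character `ψ_p` of `F_p`). -/
theorem statement7 (p : ℕ) [Fact p.Prime] (hp : 3 < p) (hp3 : p % 3 = 2)
    (F : Type) [Field F] [Fintype F] [Algebra (ZMod p) F]
    (m : ℕ) (hm : Even m) (hF : Fintype.card F = p ^ m)
    (χ : MulChar F ℂ) (hχ : orderOf χ = 3)
    (α : F) (hα : α ≠ 0)
    (ψp : AddChar (ZMod p) ℂ) (hψ : ψp ≠ 1) :
    -gaussSum χ (psiAlpha ψp α) = (χ α)⁻¹ * (-(p : ℂ)) ^ (m / 2) := by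
  obtain ⟨k, rfl⟩ := hm
  have : CharP F p := charP_of_injective_algebraMap (algebraMap (ZMod p) F).injective p
  rw [← two_mul] at hF ⊢
  have hg := gaussSum_eq_of_orderOf_eq_three hp3 hF hχ (psiAlpha_one_ne_one hψ)
    (psiAlpha_one_pow ψp)
  have hshift := gaussSum_mulShift χ (psiAlpha ψp 1) (Units.mk0 α hα)
  rw [Units.val_mk0, ← psiAlpha_eq_mulShift, hg] at hshift
  have hχα : χ α ≠ 0 := ((isUnit_iff_ne_zero.mpr hα).map χ).ne_zero
  rw [Nat.mul_div_cancel_left k two_pos, eq_inv_mul_iff_mul_eq₀ hχα, mul_neg, hshift, neg_neg]
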